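/- arXiv:1607.06090 — 14 statements merged into one kernel-verified Lean document; each statement's English description precedes it below -/
import Mathlib

section
/- Let x, a, b, c be real numbers with b² + x² ≠ 0, and let J be the 4×4 real antisymmetric matrix with rows (0, x, a, b), (−x, 0, b, c), (−a, −b, 0, x), (−b, −c, −x, 0). Set Δ := (a−c)² + 4(b² + x²) and ε± := (a + c ± √Δ)/2. Then there exists a real orthogonal 4×4 matrix O with det O = −1 such that Oᵀ J O is the block-diagonal matrix with rows (0, ε₊, 0, 0), (−ε₊, 0, 0, 0), (0, 0, 0, ε₋), (0, 0, −ε₋, 0). -/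
/-- The matrix whose columns are the real and imaginary representatives of the eigenvectors
`(b + ix, p)` and `(-p, b - ix)` of the Hermitian matrix `!![a, b + ix; b - ix, c]`,
scaled by `k`. -/
def eigenFrame (x b p k : ℝ) : Matrix (Fin 4) (Fin 4) ℝ :=
  !![k * b, -(k * x), -(k * p), 0;
     k * p, 0, k * b, k * x;
     k * x, k * b, 0, -(k * p);
     0, k * p, -(k * x), k * b]

lemma eigenFrame_transpose_mul_self {x b p k : ℝ} (hk : k ^ 2 * (b ^ 2 + x ^ 2 + p ^ 2) = 1) :
    (eigenFrame x b p k).transpose * eigenFrame x b p k = 1 := by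
  ext i j
  fin_cases i <;> fin_cases j <;>
    simp [eigenFrame, Matrix.mul_apply, Fin.sum_univ_four] <;>
    first
    | ring1
    | linear_combination hk

lemma det_eigenFrame {x b p k : ℝ} (hk : k ^ 2 * (b ^ 2 + x ^ 2 + p ^ 2) = 1) :
    (eigenFrame x b p k).det = -1 := by
  have hdet : (eigenFrame x b p k).det = -(k ^ 2 * (b ^ 2 + x ^ 2 + p ^ 2)) ^ 2 := by
    simp [eigenFrame, Matrix.det_succ_row_zero, Fin.sum_univ_succ, Fin.succAbove]
    ring
  rw [hdet, hk]
  norm_num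

lemma mul_eigenFrame {x a b c p : ℝ} (k : ℝ) (hp : p ^ 2 + (a - c) * p = b ^ 2 + x ^ 2) :
    !![0, x, a, b; -x, 0, b, c; -a, -b, 0, x; -b, -c, -x, 0] * eigenFrame x b p k =
      eigenFrame x b p k *
        !![0, a + p, 0, 0; -(a + p), 0, 0, 0; 0, 0, 0, c - p; 0, 0, -(c - p), 0] := by
  ext i j
  fin_cases i <;> fin_cases j <;>
    simp [eigenFrame, Matrix.mul_apply, Fin.sum_univ_four] <;>
    first
    | ring1
    | linear_combination k * hp
    | linear_combination -k * hp

/-- The 4×4 antisymmetric block `J` built from `x, a, b, c` can be brought to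
Williamson normal form with eigenvalues `ε± = (a + c ± √Δ)/2` by an orthogonal matrix of
determinant `-1`. -/
theorem williamson_4x4_block (x a b c : ℝ) (h : b ^ 2 + x ^ 2 ≠ 0) :
    ∃ O : Matrix (Fin 4) (Fin 4) ℝ,
      O.transpose * O = 1 ∧ O.det = -1 ∧
      O.transpose * (!![0, x, a, b; -x, 0, b, c; -a, -b, 0, x; -b, -c, -x, 0]) * O =
        !![0, (a + c + Real.sqrt ((a - c) ^ 2 + 4 * (b ^ 2 + x ^ 2))) / 2, 0, 0;
           -((a + c + Real.sqrt ((a - c) ^ 2 + 4 * (b ^ 2 + x ^ 2))) / 2), 0, 0, 0;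
           0, 0, 0, (a + c - Real.sqrt ((a - c) ^ 2 + 4 * (b ^ 2 + x ^ 2))) / 2;
           0, 0, -((a + c - Real.sqrt ((a - c) ^ 2 + 4 * (b ^ 2 + x ^ 2))) / 2), 0] := by
  set s := Real.sqrt ((a - c) ^ 2 + 4 * (b ^ 2 + x ^ 2))
  have hs : s ^ 2 = (a - c) ^ 2 + 4 * (b ^ 2 + x ^ 2) := Real.sq_sqrt (by positivity)
  obtain ⟨p, hps⟩ : ∃ p, p = (c - a + s) / 2 := ⟨_, rfl⟩
  have hp : p ^ 2 + (a - c) * p = b ^ 2 + x ^ 2 := by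
    rw [hps]
    linear_combination hs / 4
  have hN : 0 < b ^ 2 + x ^ 2 + p ^ 2 := by positivity
  have hk : (Real.sqrt (b ^ 2 + x ^ 2 + p ^ 2))⁻¹ ^ 2 * (b ^ 2 + x ^ 2 + p ^ 2) = 1 := by
    rw [inv_pow, Real.sq_sqrt hN.le, inv_mul_cancel₀ hN.ne']
  have hplus : (a + c + s) / 2 = a + p := by rw [hps]; ring
  have hminus : (a + c - s) / 2 = c - p := by rw [hps]; ring
  refine ⟨_, eigenFrame_transpose_mul_self hk, det_eigenFrame hk, ?_⟩
  rw [Matrix.mul_assoc, mul_eigenFrame _ hp, ← Matrix.mul_assoc,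
    eigenFrame_transpose_mul_self hk, Matrix.one_mul, hplus, hminus]
end

section
/- For every positive integer n, the real n×n matrix R_n with entries (R_n)_{kl} = √(2/n)·cos(2πkl/n − π/4) for 0 ≤ k, l < n is symmetric (R_nᵀ = R_n) and is an involution (R_n · R_n = 1); in particular R_n is orthogonal. -/
theorem sum_exp_two_pi_mul_I {n : ℕ} (hn : n ≠ 0) (d : ℤ) :
    ∑ l : Fin n, Complex.exp ((2 * Real.pi * d * (l : ℕ) / n : ℝ) * Complex.I) =
      if (n : ℤ) ∣ d then (n : ℂ) else 0 := by
  have hζ := Complex.isPrimitiveRoot_exp n hn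
  set ζ := Complex.exp (2 * Real.pi * Complex.I / n) with hζ_def
  have hterm (l : ℕ) :
      Complex.exp ((2 * Real.pi * d * l / n : ℝ) * Complex.I) = (ζ ^ d) ^ l := by
    rw [hζ_def, ← Complex.exp_int_mul, ← Complex.exp_nat_mul]
    congr 1
    push_cast
    ring
  simp_rw [hterm]
  rw [Fin.sum_univ_eq_sum_range (fun l => (ζ ^ d) ^ l)]
  split_ifs with h
  · simp [(hζ.zpow_eq_one_iff_dvd d).2 h]
  · have hne : ζ ^ d ≠ 1 := fun h1 => h ((hζ.zpow_eq_one_iff_dvd d).1 h1)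
    have hpow : (ζ ^ d) ^ n = 1 := by
      rw [← zpow_natCast, zpow_comm, zpow_natCast, hζ.pow_eq_one, one_zpow]
    rw [geom_sum_eq hne, hpow, sub_self, zero_div]

theorem sum_cos_two_pi_mul {n : ℕ} (hn : n ≠ 0) (d : ℤ) :
    ∑ l : Fin n, Real.cos (2 * Real.pi * d * (l : ℕ) / n) =
      if (n : ℤ) ∣ d then (n : ℝ) else 0 := by
  have h := congrArg Complex.re (sum_exp_two_pi_mul_I hn d)
  simp only [Complex.re_sum, Complex.exp_ofReal_mul_I_re] at h
  rw [h]
  split_ifs <;> simp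

theorem sum_sin_two_pi_mul {n : ℕ} (hn : n ≠ 0) (d : ℤ) :
    ∑ l : Fin n, Real.sin (2 * Real.pi * d * (l : ℕ) / n) = 0 := by
  have h := congrArg Complex.im (sum_exp_two_pi_mul_I hn d)
  simp only [Complex.im_sum, Complex.exp_ofReal_mul_I_im] at h
  rw [h]
  split_ifs <;> simp

theorem two_mul_cos_sub_pi_div_four_mul_cos (x y : ℝ) :
    2 * (Real.cos (x - Real.pi / 4) * Real.cos (y - Real.pi / 4)) =
      Real.cos (x - y) + Real.sin (x + y) := by
  rw [← mul_assoc, Real.two_mul_cos_mul_cos, ← Real.cos_sub_pi_div_two (x + y)]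
  ring_nf

/-- The Real DFT matrix `R_n` with entries `√(2/n)·cos(2πkl/n − π/4)` is
symmetric and an involution (hence orthogonal). -/
theorem realDFT_symmetric_involutive (n : ℕ) (hn : 0 < n)
    (R : Matrix (Fin n) (Fin n) ℝ)
    (hR : ∀ k l : Fin n,
      R k l = Real.sqrt (2 / n) *
        Real.cos (2 * Real.pi * (k : ℕ) * (l : ℕ) / n - Real.pi / 4)) :
    R.transpose = R ∧ R * R = 1 := by
  have hn0 : n ≠ 0 := hn.ne'
  have hnR : (n : ℝ) ≠ 0 := Nat.cast_ne_zero.2 hn0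
  refine ⟨?_, ?_⟩
  · ext k l
    rw [Matrix.transpose_apply, hR, hR, mul_right_comm (2 * Real.pi)]
  · ext k m
    have hterm (l : Fin n) : R k l * R l m =
        (1 / n) * (Real.cos (2 * Real.pi * ((k : ℤ) - (m : ℤ) : ℤ) * (l : ℕ) / n) +
          Real.sin (2 * Real.pi * ((k : ℤ) + (m : ℤ) : ℤ) * (l : ℕ) / n)) := by
      have hsqrt : Real.sqrt (2 / n) * Real.sqrt (2 / n) = 2 / n :=
        Real.mul_self_sqrt (by positivity)
      have hcos := two_mul_cos_sub_pi_div_four_mul_cos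
        (2 * Real.pi * (k : ℕ) * (l : ℕ) / n) (2 * Real.pi * (l : ℕ) * (m : ℕ) / n)
      have hsub : 2 * Real.pi * ((k : ℤ) - (m : ℤ) : ℤ) * (l : ℕ) / n =
          2 * Real.pi * (k : ℕ) * (l : ℕ) / n - 2 * Real.pi * (l : ℕ) * (m : ℕ) / n := by
        push_cast
        ring
      have hadd : 2 * Real.pi * ((k : ℤ) + (m : ℤ) : ℤ) * (l : ℕ) / n =
          2 * Real.pi * (k : ℕ) * (l : ℕ) / n + 2 * Real.pi * (l : ℕ) * (m : ℕ) / n := by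
        push_cast
        ring
      rw [hR, hR, hsub, hadd, ← hcos, mul_mul_mul_comm, hsqrt]
      ring
    have hdvd : (n : ℤ) ∣ (k : ℤ) - (m : ℤ) ↔ k = m := by
      refine ⟨fun h => Fin.ext ?_, fun h => by simp [h]⟩
      have hlt : |(k : ℤ) - (m : ℤ)| < n := by
        rw [abs_lt]
        omega
      have := Int.eq_zero_of_abs_lt_dvd h hlt
      omega
    simp_rw [Matrix.mul_apply, hterm]
    rw [← Finset.mul_sum, Finset.sum_add_distrib, sum_cos_two_pi_mul hn0,
      sum_sin_two_pi_mul hn0, add_zero, Matrix.one_apply]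
    simp only [hdvd]
    split_ifs
    · exact one_div_mul_cancel hnR
    · exact mul_zero _
end

section
/- Let n be a positive integer, let h : ZMod n → Matrix (Fin 2) (Fin 2) ℝ be arbitrary, and let H be the 2n×2n block-circulant matrix indexed by ZMod n × Fin 2 with 2×2 blocks H_{(k),(l)} = h(l − k). Let R_n ⊗ I₂ denote the Kronecker product of the Real DFT matrix R_n with the 2×2 identity. Then for all a, b ∈ ZMod n, the (a,b) 2×2 block of (R_n ⊗ I₂) H (R_n ⊗ I₂) equals [a = b]·(Σ_{q ∈ ZMod n} cos(2πbq/n)·h(q)) + [a + b = 0]·(Σ_{q ∈ ZMod n} sin(2πbq/n)·h(q)), where [·] is the indicator (in particular the block vanishes unless b = a or b = −a). Here cos(2πbq/n) means cosine evaluated at 2π·b̄·q̄/n for the canonical representatives b̄, q̄ ∈ {0,…,n−1}. -/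
open Kronecker

open ZMod in
theorem stdAddChar_mul_eq_exp {n : ℕ} [NeZero n] (x y : ZMod n) :
    stdAddChar (x * y) =
      Complex.exp ((2 * Real.pi * x.val * y.val / n : ℝ) * Complex.I) := by
  have hxy : x * y = ((x.val * y.val : ℕ) : ZMod n) := by simp
  rw [hxy, stdAddChar_apply, toCircle_natCast]
  congr 1
  push_cast
  ring

open ZMod in
theorem cos_two_pi_val_mul_val_div {n : ℕ} [NeZero n] (x y : ZMod n) :
    Real.cos (2 * Real.pi * x.val * y.val / n) = (stdAddChar (x * y)).re := by
  rw [stdAddChar_mul_eq_exp, Complex.exp_ofReal_mul_I_re]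

open ZMod in
theorem sin_two_pi_val_mul_val_div {n : ℕ} [NeZero n] (x y : ZMod n) :
    Real.sin (2 * Real.pi * x.val * y.val / n) = (stdAddChar (x * y)).im := by
  rw [stdAddChar_mul_eq_exp, Complex.exp_ofReal_mul_I_im]

open ZMod in
theorem sum_stdAddChar_mul_add {n : ℕ} [NeZero n] (c d : ZMod n) :
    ∑ k : ZMod n, stdAddChar (k * c + d) =
      (if c = 0 then (n : ℂ) else 0) * stdAddChar d := by
  simp_rw [AddChar.map_add_eq_mul, ← Finset.sum_mul]
  rw [AddChar.sum_mulShift c (isPrimitive_stdAddChar n), ZMod.card]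
  push_cast
  rfl

open ZMod in
theorem two_mul_cos_sub_pi_div_four_mul_cos_sub_pi_div_four {n : ℕ} [NeZero n]
    (a b k l : ZMod n) :
    2 * (Real.cos (2 * Real.pi * a.val * k.val / n - Real.pi / 4) *
        Real.cos (2 * Real.pi * l.val * b.val / n - Real.pi / 4)) =
      (stdAddChar (a * k - l * b)).re + (stdAddChar (a * k + l * b)).im := by
  rw [sub_eq_add_neg (a * k), AddChar.map_add_eq_mul, AddChar.map_add_eq_mul,
    AddChar.map_neg_eq_conj]
  simp only [Complex.mul_re, Complex.mul_im, Complex.conj_re, Complex.conj_im,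
    ← cos_two_pi_val_mul_val_div, ← sin_two_pi_val_mul_val_div, Real.cos_sub,
    Real.cos_pi_div_four, Real.sin_pi_div_four]
  have h2 : Real.sqrt 2 * Real.sqrt 2 = 2 := Real.mul_self_sqrt (by norm_num)
  generalize Real.cos (2 * Real.pi * a.val * k.val / n) = c₁
  generalize Real.cos (2 * Real.pi * l.val * b.val / n) = c₂
  generalize Real.sin (2 * Real.pi * a.val * k.val / n) = s₁
  generalize Real.sin (2 * Real.pi * l.val * b.val / n) = s₂
  linear_combination ((c₁ + s₁) * (c₂ + s₂) / 2) * h2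

open ZMod in
/-- The shifted product of two Real DFT matrices. -/
theorem sum_realDFT_mul_shift {n : ℕ} [NeZero n] (R : Matrix (ZMod n) (ZMod n) ℝ)
    (hR : ∀ k l : ZMod n,
      R k l = Real.sqrt (2 / n) *
        Real.cos (2 * Real.pi * k.val * l.val / n - Real.pi / 4))
    (a b q : ZMod n) :
    ∑ k : ZMod n, R a k * R (q + k) b =
      (if a = b then (1 : ℝ) else 0) * Real.cos (2 * Real.pi * b.val * q.val / n) +
        (if a + b = 0 then (1 : ℝ) else 0) *
          Real.sin (2 * Real.pi * b.val * q.val / n) := by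
  have hn : (n : ℝ) ≠ 0 := Nat.cast_ne_zero.mpr (NeZero.ne n)
  have hs : Real.sqrt (2 / n) * Real.sqrt (2 / n) = 2 / n := Real.mul_self_sqrt (by positivity)
  have hterm : ∀ k : ZMod n, R a k * R (q + k) b =
      (n : ℝ)⁻¹ * ((stdAddChar (k * (a - b) + -(b * q))).re +
        (stdAddChar (k * (a + b) + b * q)).im) := by
    intro k
    have h := two_mul_cos_sub_pi_div_four_mul_cos_sub_pi_div_four a b k (q + k)
    rw [show k * (a - b) + -(b * q) = a * k - (q + k) * b by ring,
      show k * (a + b) + b * q = a * k + (q + k) * b by ring, ← h, hR, hR,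
      mul_mul_mul_comm, hs]
    ring
  simp_rw [hterm]
  rw [← Finset.mul_sum, Finset.sum_add_distrib, ← Complex.re_sum, ← Complex.im_sum,
    sum_stdAddChar_mul_add, sum_stdAddChar_mul_add, cos_two_pi_val_mul_val_div,
    sin_two_pi_val_mul_val_div, AddChar.map_neg_eq_conj]
  simp only [sub_eq_zero]
  split_ifs <;> simp <;> field_simp

/-- Block-diagonalization of a block-circulant matrix with 2×2 blocks by the
Real DFT conjugation `(R_n ⊗ I₂) H (R_n ⊗ I₂)`: the `(a,b)` block is supported on `b = a`
and `b = -a`, with cosine resp. sine Fourier coefficients of the blocks. -/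
theorem realDFT_block_circulant (n : ℕ) [NeZero n]
    (h : ZMod n → Matrix (Fin 2) (Fin 2) ℝ)
    (H : Matrix (ZMod n × Fin 2) (ZMod n × Fin 2) ℝ)
    (hH : ∀ k l : ZMod n, ∀ α β : Fin 2, H (k, α) (l, β) = h (l - k) α β)
    (R : Matrix (ZMod n) (ZMod n) ℝ)
    (hR : ∀ k l : ZMod n,
      R k l = Real.sqrt (2 / n) *
        Real.cos (2 * Real.pi * k.val * l.val / n - Real.pi / 4)) :
    ∀ a b : ZMod n, ∀ α β : Fin 2,
      ((R ⊗ₖ (1 : Matrix (Fin 2) (Fin 2) ℝ)) * H * (R ⊗ₖ (1 : Matrix (Fin 2) (Fin 2) ℝ)))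
          (a, α) (b, β) =
        (if a = b then (1 : ℝ) else 0) *
            (∑ q : ZMod n, Real.cos (2 * Real.pi * b.val * q.val / n) * h q α β) +
          (if a + b = 0 then (1 : ℝ) else 0) *
            (∑ q : ZMod n, Real.sin (2 * Real.pi * b.val * q.val / n) * h q α β) := by
  intro a b α β
  have hblock : ((R ⊗ₖ (1 : Matrix (Fin 2) (Fin 2) ℝ)) * H *
      (R ⊗ₖ (1 : Matrix (Fin 2) (Fin 2) ℝ))) (a, α) (b, β) =
      ∑ l : ZMod n, ∑ k : ZMod n, R a k * h (l - k) α β * R l b := by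
    simp [Matrix.mul_apply, Fintype.sum_prod_type, Matrix.one_apply, hH, Finset.sum_mul]
  have hshift : ∀ k : ZMod n, ∑ l : ZMod n, R a k * h (l - k) α β * R l b =
      ∑ q : ZMod n, R a k * R (q + k) b * h q α β := by
    intro k
    rw [← Equiv.sum_comp (Equiv.addRight k)]
    refine Finset.sum_congr rfl fun q _ => ?_
    simp only [Equiv.coe_addRight, add_sub_cancel_right]
    ring
  rw [hblock, Finset.sum_comm]
  simp_rw [hshift]
  rw [Finset.sum_comm]
  simp_rw [← Finset.sum_mul, sum_realDFT_mul_shift R hR, Finset.mul_sum]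
  rw [← Finset.sum_add_distrib]
  exact Finset.sum_congr rfl fun q _ => by ring
end

section
/- Let m be a positive integer, let Q be the quadratic form on ℝ^m given by Q(x) = Σᵢ xᵢ², and let ι : ℝ^m → CliffordAlgebra Q be the canonical embedding. Let u ∈ ℝ^m be a unit vector and let O = 1 − 2·u uᵀ be the reflection across the hyperplane orthogonal to u. Then the ordered product ι(O·e_0)·ι(O·e_1)⋯ι(O·e_{m−1}) equals −ι(e_0)·ι(e_1)⋯ι(e_{m−1}), where (e_0, …, e_{m−1}) is the standard basis of ℝ^m. -/
/-- Moving a generator past a word in pairwise anticommuting generators costs one sign for each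
letter of the word that differs from it. -/
theorem mul_list_prod_of_pairwise_anticommute {I A : Type*} [DecidableEq I] [Ring A] {e : I → A}
    (he : Pairwise fun i j => e i * e j = -(e j * e i)) (i : I) (l : List I) :
    e i * (l.map e).prod = (-1 : ℤ) ^ (l.length + l.count i) • ((l.map e).prod * e i) := by
  induction l with
  | nil => simp
  | cons j l ih =>
    rcases eq_or_ne i j with rfl | hij
    · simp only [List.map_cons, List.prod_cons, List.length_cons, List.count_cons_self]
      rw [show l.length + 1 + (l.count i + 1) = l.length + l.count i + 2 by ring, pow_add,
        neg_one_sq, mul_one, mul_assoc, ← mul_smul_comm, ← ih]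
    · simp only [List.map_cons, List.prod_cons, List.length_cons, List.count_cons_of_ne hij.symm]
      rw [← mul_assoc, he hij, neg_mul, mul_assoc, ih, mul_smul_comm, add_right_comm, pow_succ]
      simp [mul_assoc]

/-- Negated conjugation by an involution of every factor of a product. -/
theorem list_prod_map_neg_conj {I A : Type*} [Ring A] {U : A} (hU : U * U = 1) (e : I → A)
    (l : List I) :
    (l.map fun i => -(U * e i * U)).prod = (-1 : ℤ) ^ l.length • (U * (l.map e).prod * U) := by
  induction l with
  | nil => simp [hU]
  | cons j l ih =>
    have h : U * e j * U * (U * (l.map e).prod * U) = U * (e j * (l.map e).prod) * U := by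
      linear_combination (norm := noncomm_ring) U * e j * hU * ((l.map e).prod * U)
    simp only [List.map_cons, List.prod_cons, List.length_cons]
    rw [ih, mul_smul_comm, neg_mul, h, pow_succ]
    simp

/-- In the Clifford algebra of the standard positive-definite quadratic form on
`ℝ^m`, a reflection `O = 1 − 2·u uᵀ` across the hyperplane orthogonal to a unit vector `u`
flips the sign of the ordered product of the generators: the ordered product of the images of
the columns of `O` equals minus the ordered product of the images of the standard basis. -/
theorem clifford_pseudoscalar_reflection (m : ℕ) (hm : 0 < m)
    (Q : QuadraticForm ℝ (Fin m → ℝ)) (hQ : ∀ v : Fin m → ℝ, Q v = ∑ i, v i ^ 2)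
    (u : Fin m → ℝ) (hu : ∑ i, u i ^ 2 = 1) :
    (List.ofFn fun i : Fin m =>
        CliffordAlgebra.ι Q
          (fun k => ((1 : Matrix (Fin m) (Fin m) ℝ) - (2 : ℝ) • Matrix.vecMulVec u u) k i)).prod
      = -(List.ofFn fun i : Fin m =>
          CliffordAlgebra.ι Q (Pi.single i (1 : ℝ))).prod := by
  have hpolar (x y : Fin m → ℝ) : QuadraticMap.polar Q x y = 2 * ∑ k, x k * y k := by
    simp only [QuadraticMap.polar, hQ, Pi.add_apply, Finset.mul_sum, ← Finset.sum_sub_distrib]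
    exact Finset.sum_congr rfl fun k _ => by ring
  set e : Fin m → CliffordAlgebra Q := fun i => CliffordAlgebra.ι Q (Pi.single i (1 : ℝ)) with he
  set U := CliffordAlgebra.ι Q u with hUdef
  have hQu : Q u = 1 := (hQ u).trans hu
  have hU : U * U = 1 := by rw [hUdef, CliffordAlgebra.ι_sq_scalar, hQu, map_one]
  have hcol (i : Fin m) : CliffordAlgebra.ι Q
      (fun k => ((1 : Matrix (Fin m) (Fin m) ℝ) - (2 : ℝ) • Matrix.vecMulVec u u) k i)
      = -(U * e i * U) := by
    rw [hUdef, he, CliffordAlgebra.ι_mul_ι_mul_ι, ← map_neg, hpolar, hQu]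
    congr 1
    ext k
    simp [Matrix.vecMulVec_apply, Matrix.one_apply, Pi.single_apply]
    ring
  have hanti : Pairwise fun i j => e i * e j = -(e j * e i) := fun i j hij => by
    simp only [he]
    rw [eq_neg_iff_add_eq_zero, CliffordAlgebra.ι_mul_ι_add_swap, hpolar]
    simp [Pi.single_apply, hij.symm]
  have hUsum : U = ∑ i, u i • e i := by
    simp only [hUdef, he, ← map_smul, ← map_sum]
    congr 1
    ext k
    simp [Finset.sum_apply, Pi.single_apply]
  have hcomm : U * ((List.finRange m).map e).prod
      = (-1 : ℤ) ^ (m + 1) • (((List.finRange m).map e).prod * U) := by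
    rw [hUsum, Finset.sum_mul, Finset.mul_sum, Finset.smul_sum]
    refine Finset.sum_congr rfl fun i _ => ?_
    rw [smul_mul_assoc, mul_list_prod_of_pairwise_anticommute hanti, mul_smul_comm, smul_comm,
      List.length_finRange, List.count_eq_one_of_mem (List.nodup_finRange m) (List.mem_finRange i)]
  simp only [hcol, List.ofFn_eq_map]
  rw [list_prod_map_neg_conj hU, hcomm, smul_mul_assoc, mul_assoc, hU, mul_one, smul_smul,
    List.length_finRange, ← pow_add, Odd.neg_one_pow ⟨m, by ring⟩, neg_one_smul]
end

section
/- Let S be a nonempty finite type and f⁰ : S → S → ℝ. Define recursively f^{t+1}(x, y) = min over z ∈ S of (f^t(x, z) + f^t(z, y)). Then for every natural number t and all x, y ∈ S, f^t(x, y) equals the minimum over all sequences z : Fin (2^t + 1) → S with z 0 = x and z (2^t) = y of Σ_{j=0}^{2^t − 1} f⁰(z j, z (j+1)). -/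
/-- The costs `∑ j < n, c (z j) (z (j + 1))` of all chains of length `n` from `x` to `y`. -/
def chainCosts {S : Type*} (c : S → S → ℝ) (n : ℕ) (x y : S) : Set ℝ :=
  {v | ∃ z : ℕ → S, z 0 = x ∧ z n = y ∧ v = ∑ j ∈ Finset.range n, c (z j) (z (j + 1))}

lemma fin_chainCosts_eq {S : Type*} (c : S → S → ℝ) (n : ℕ) (x y : S) :
    {v : ℝ | ∃ z : Fin (n + 1) → S, z 0 = x ∧ z (Fin.last n) = y ∧
      v = ∑ j : Fin n, c (z j.castSucc) (z j.succ)} = chainCosts c n x y := by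
  ext v
  constructor
  · rintro ⟨z, hx, hy, rfl⟩
    refine ⟨fun i => z (Fin.ofNat (n + 1) i), hx, ?_, ?_⟩
    · have hlast : Fin.ofNat (n + 1) n = Fin.last n := Fin.ext (Nat.mod_eq_of_lt n.lt_succ_self)
      simpa only [hlast] using hy
    · rw [Finset.sum_range]
      refine Finset.sum_congr rfl fun j _ => ?_
      have hcast : Fin.ofNat (n + 1) j = j.castSucc := Fin.ext (Nat.mod_eq_of_lt (by omega))
      have hsucc : Fin.ofNat (n + 1) (j + 1) = j.succ := Fin.ext (Nat.mod_eq_of_lt (by omega))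
      simp only [hcast, hsucc]
  · rintro ⟨z, hx, hy, rfl⟩
    exact ⟨fun i => z i, hx, by simpa using hy, by simp [Finset.sum_range]⟩

lemma mem_chainCosts_add {S : Type*} {c : S → S → ℝ} {m n : ℕ} {x y : S} {v : ℝ} :
    v ∈ chainCosts c (m + n) x y ↔
      ∃ w, ∃ a ∈ chainCosts c m x w, ∃ b ∈ chainCosts c n w y, v = a + b := by
  constructor
  · rintro ⟨z, hx, hy, rfl⟩
    exact ⟨z m, _, ⟨z, hx, rfl, rfl⟩, _, ⟨fun i => z (m + i), rfl, hy, rfl⟩,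
      Finset.sum_range_add _ m n⟩
  · rintro ⟨w, _, ⟨z, hx, hw, rfl⟩, _, ⟨z', hw', hy, rfl⟩, rfl⟩
    have hleft : ∀ i ≤ m, (if i ≤ m then z i else z' (i - m)) = z i := fun i hi => if_pos hi
    have hright : ∀ i, (if m + i ≤ m then z (m + i) else z' (m + i - m)) = z' i := by
      rintro (_ | i)
      · simp [hw, hw']
      · simp
    refine ⟨fun i => if i ≤ m then z i else z' (i - m), by simpa using hx,
      (hright n).trans hy, ?_⟩
    rw [Finset.sum_range_add]
    congr 1
    · refine Finset.sum_congr rfl fun j hj => ?_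
      have hjm := Finset.mem_range.mp hj
      simp only [hleft j hjm.le, hleft (j + 1) hjm]
    · refine Finset.sum_congr rfl fun j _ => ?_
      simp only [add_assoc, hright j, hright (j + 1)]

lemma isLeast_chainCosts_add {S : Type*} [Fintype S] [Nonempty S] {c g h : S → S → ℝ} {m n : ℕ}
    (hg : ∀ x y, IsLeast (chainCosts c m x y) (g x y))
    (hh : ∀ x y, IsLeast (chainCosts c n x y) (h x y)) (x y : S) :
    IsLeast (chainCosts c (m + n) x y)
      (Finset.univ.inf' Finset.univ_nonempty fun z => g x z + h z y) := by
  constructor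
  · obtain ⟨w, -, hw⟩ := Finset.exists_mem_eq_inf' Finset.univ_nonempty fun z => g x z + h z y
    exact mem_chainCosts_add.mpr ⟨w, _, (hg x w).1, _, (hh w y).1, hw⟩
  · intro v hv
    obtain ⟨w, a, ha, b, hb, rfl⟩ := mem_chainCosts_add.mp hv
    exact (Finset.inf'_le _ (Finset.mem_univ w)).trans (add_le_add ((hg x w).2 ha) ((hh w y).2 hb))

/-- The doubling lemma: if `f (t+1) x y = min_z (f t x z + f t z y)`, then
`f t x y` is the minimum over all chains `z : Fin (2^t + 1) → S` with endpoints `x`, `y` of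
the total cost `Σ_{j < 2^t} f 0 (z j) (z (j+1))`. -/
theorem doubling_lemma (S : Type*) [Fintype S] [Nonempty S]
    (f : ℕ → S → S → ℝ)
    (hf : ∀ (t : ℕ) (x y : S),
      f (t + 1) x y =
        Finset.univ.inf' Finset.univ_nonempty (fun z : S => f t x z + f t z y)) :
    ∀ (t : ℕ) (x y : S),
      IsLeast
        {v : ℝ | ∃ z : Fin (2 ^ t + 1) → S, z 0 = x ∧ z (Fin.last (2 ^ t)) = y ∧
          v = ∑ j : Fin (2 ^ t), f 0 (z j.castSucc) (z j.succ)}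
        (f t x y) := by
  intro t
  induction t with
  | zero =>
    intro x y
    rw [fin_chainCosts_eq]
    refine ⟨⟨fun i => if i = 0 then x else y, by simp, by simp, by simp⟩, ?_⟩
    rintro v ⟨z, rfl, rfl, rfl⟩
    simp
  | succ t ih =>
    intro x y
    simp only [fin_chainCosts_eq] at ih ⊢
    rw [hf, pow_succ, mul_two]
    exact isLeast_chainCosts_add ih ih x y
end

section
/- Let m ≥ 2 be an integer. For functions A, B : Fin m → ℝ taking values in {−1, 1}, extended by the convention A(−1) := −A(m−1), define I_chain(A, B) := Σ_{i=0}^{m−1} ( A(m−i−2)·B(i) + A(m−i−1)·B(i) ). Then the minimum of I_chain(A, B) over all such ±1-valued assignments equals −2(m−1). -/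
/-- For signs `x`, `y`, `b`, `s`, the sum `x * b + y * b` is at least `-2 + s * (y - x)`. -/
theorem neg_two_add_mul_sub_le_of_signs {x y b s : ℝ} (hx : x = 1 ∨ x = -1) (hy : y = 1 ∨ y = -1)
    (hb : b = 1 ∨ b = -1) (hs : s = 1 ∨ s = -1) : -2 + s * (y - x) ≤ x * b + y * b := by
  rcases hx with rfl | rfl <;> rcases hy with rfl | rfl <;> rcases hb with rfl | rfl <;>
    rcases hs with rfl | rfl <;> norm_num

/-- The classical bound of the chained Bell inequality: the minimum of
`I_chain(A,B) = Σ_{i<m} (A(m−i−2) + A(m−i−1))·B(i)` over ±1-valued assignments (with the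
convention `A(−1) = −A(m−1)`) equals `−2(m−1)`. -/
theorem chained_classical_bound (m : ℕ) (hm : 2 ≤ m) :
    IsLeast
      {v : ℝ | ∃ A B : ℤ → ℝ,
        (∀ k : ℤ, 0 ≤ k → k < m → A k = 1 ∨ A k = -1) ∧
        (∀ k : ℤ, 0 ≤ k → k < m → B k = 1 ∨ B k = -1) ∧
        A (-1) = -A ((m : ℤ) - 1) ∧
        v = ∑ i ∈ Finset.range m,
          (A ((m : ℤ) - (i : ℤ) - 2) * B (i : ℤ) + A ((m : ℤ) - (i : ℤ) - 1) * B (i : ℤ))}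
      (-2 * ((m : ℝ) - 1)) := by
  constructor
  · refine ⟨fun k => if 0 ≤ k then 1 else -1, fun _ => -1, ?_, ?_, ?_, ?_⟩
    · intro k hk _
      simp [hk]
    · simp
    · have h : (0 : ℤ) ≤ (m : ℤ) - 1 := by omega
      simp only [if_pos h]
      norm_num
    · obtain ⟨n, rfl⟩ : ∃ n, m = n + 1 := ⟨m - 1, by omega⟩
      rw [Finset.sum_range_succ, Finset.sum_congr rfl (g := fun _ => (-2 : ℝ))]
      · have h₁ : ¬ (0 : ℤ) ≤ ((n + 1 : ℕ) : ℤ) - n - 2 := by omega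
        have h₂ : (0 : ℤ) ≤ ((n + 1 : ℕ) : ℤ) - n - 1 := by omega
        simp only [if_neg h₁, if_pos h₂, Finset.sum_const, Finset.card_range, nsmul_eq_mul]
        push_cast
        ring
      · intro i hi
        have hi := Finset.mem_range.mp hi
        have h₁ : (0 : ℤ) ≤ ((n + 1 : ℕ) : ℤ) - i - 2 := by omega
        have h₂ : (0 : ℤ) ≤ ((n + 1 : ℕ) : ℤ) - i - 1 := by omega
        simp only [if_pos h₁, if_pos h₂]
        norm_num
  · rintro v ⟨A, B, hA, hB, hneg, rfl⟩
    have hlast := hA ((m : ℤ) - 1) (by omega) (by omega)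
    have hA' : ∀ k : ℤ, -1 ≤ k → k < m → A k = 1 ∨ A k = -1 := by
      intro k hk hkm
      rcases hk.eq_or_lt with rfl | hk
      · rw [hneg]
        rcases hlast with h | h <;> simp [h]
      · exact hA k (by omega) hkm
    have htel : ∑ i ∈ Finset.range m, (A ((m : ℤ) - i - 1) - A ((m : ℤ) - i - 2)) =
        A ((m : ℤ) - 1) - A (-1) := by
      convert Finset.sum_range_sub' (fun i : ℕ => A ((m : ℤ) - i - 1)) m using 3
      · congr 1
        push_cast
        ring
      · simp
      · simp
    calc -2 * ((m : ℝ) - 1)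
        = ∑ i ∈ Finset.range m,
            (-2 + A ((m : ℤ) - 1) * (A ((m : ℤ) - i - 1) - A ((m : ℤ) - i - 2))) := by
          rw [Finset.sum_add_distrib, ← Finset.mul_sum, htel, hneg]
          simp only [Finset.sum_const, Finset.card_range, nsmul_eq_mul]
          rcases hlast with h | h <;> rw [h] <;> ring
      _ ≤ _ := by
          refine Finset.sum_le_sum fun i hi => ?_
          have hi := Finset.mem_range.mp hi
          exact neg_two_add_mul_sub_le_of_signs (hA' _ (by omega) (by omega))
            (hA' _ (by omega) (by omega)) (hB _ (by omega) (by omega)) hlast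
end

section
/- Let m ≥ 2 be an integer, let σx and σy be the Pauli matrices [[0,1],[1,0]] and [[0,−i],[i,0]] over ℂ, and for i ∈ ℤ define φ_i := (i+1)π/m and A_i := sin(φ_i)·σx − cos(φ_i)·σy. Then Σ_{i=0}^{m−1} ( A_{m−i−2} ⊗ A_i + A_{m−i−1} ⊗ A_i ) = m·cos²(π/(2m))·(σx ⊗ σx − σy ⊗ σy) + (m/2)·sin(π/m)·(σx ⊗ σy + σy ⊗ σx), where ⊗ is the Kronecker product of 2×2 complex matrices. -/
open Kronecker

theorem sum_range_cos_add_eq_zero {m : ℕ} (hm : 2 ≤ m) (c : ℝ) :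
    ∑ i ∈ Finset.range m, Real.cos (2 * Real.pi * i / m + c) = 0 := by
  have hζ := (Complex.isPrimitiveRoot_exp m (by lia)).geom_sum_eq_zero (by lia)
  have hterm (i : ℕ) : Real.cos (2 * Real.pi * i / m + c) =
      (Complex.exp (2 * Real.pi * Complex.I / m) ^ i * Complex.exp (c * Complex.I)).re := by
    rw [← Complex.exp_nat_mul, ← Complex.exp_add, ← Complex.exp_ofReal_mul_I_re]
    congr 2
    push_cast
    ring
  simp_rw [hterm]
  rw [← Complex.re_sum, ← Finset.sum_mul, hζ, zero_mul, Complex.zero_re]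

theorem sum_range_sin_add_eq_zero {m : ℕ} (hm : 2 ≤ m) (c : ℝ) :
    ∑ i ∈ Finset.range m, Real.sin (2 * Real.pi * i / m + c) = 0 := by
  rw [← sum_range_cos_add_eq_zero hm (c - Real.pi / 2)]
  refine Finset.sum_congr rfl fun i _ => ?_
  rw [← add_sub_assoc, Real.cos_sub_pi_div_two]

/-- The Kronecker products of an equatorial observable at angle `t` with those at angles
`π - t` and `π - (t - 2 * d)`, expanded in the double angles. -/
theorem kronecker_add_kronecker_eq {n : Type*} (X Y : Matrix n n ℂ) (t d : ℝ) :
    ((Real.sin t : ℂ) • X + (Real.cos t : ℂ) • Y) ⊗ₖ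
        ((Real.sin t : ℂ) • X - (Real.cos t : ℂ) • Y) +
      ((Real.sin (t - 2 * d) : ℂ) • X + (Real.cos (t - 2 * d) : ℂ) • Y) ⊗ₖ
        ((Real.sin t : ℂ) • X - (Real.cos t : ℂ) • Y) =
      ((Real.cos d : ℂ) ^ 2) • (X ⊗ₖ X - Y ⊗ₖ Y) +
        ((Real.sin (2 * d) : ℂ) / 2) • (X ⊗ₖ Y + Y ⊗ₖ X) -
      (((Real.cos (2 * t) + Real.cos (2 * t - 2 * d) : ℝ) : ℂ) • (1 / 2 : ℂ) • (X ⊗ₖ X + Y ⊗ₖ Y) +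
        ((Real.sin (2 * t) + Real.sin (2 * t - 2 * d) : ℝ) : ℂ) •
          (1 / 2 : ℂ) • (X ⊗ₖ Y - Y ⊗ₖ X)) := by
  ext ⟨i, j⟩ ⟨k, l⟩
  simp only [Matrix.add_apply, Matrix.sub_apply, Matrix.smul_apply, Matrix.kroneckerMap_apply,
    smul_eq_mul, Real.sin_sub, Real.cos_sub, Real.sin_two_mul, Real.cos_two_mul]
  push_cast
  linear_combination (2 * Complex.cos d ^ 2 * X i k * X j l +
    2 * Complex.cos d * Complex.sin d * Y i k * X j l) * Complex.sin_sq_add_cos_sq t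

/-- The two-qubit Bell operator of the chained inequality with the optimal
observables `A_i = sin(φ_i)σx − cos(φ_i)σy`, `φ_i = (i+1)π/m`, equals
`m cos²(π/2m)(σx⊗σx − σy⊗σy) + (m/2) sin(π/m)(σx⊗σy + σy⊗σx)`. -/
theorem chained_bell_operator_XY_form (m : ℕ) (hm : 2 ≤ m) :
    let σx : Matrix (Fin 2) (Fin 2) ℂ := !![0, 1; 1, 0]
    let σy : Matrix (Fin 2) (Fin 2) ℂ := !![0, -Complex.I; Complex.I, 0]
    let φ : ℤ → ℝ := fun i => ((i : ℝ) + 1) * Real.pi / m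
    let A : ℤ → Matrix (Fin 2) (Fin 2) ℂ := fun i =>
      (Real.sin (φ i) : ℂ) • σx - (Real.cos (φ i) : ℂ) • σy
    ∑ i ∈ Finset.range m,
        (A ((m : ℤ) - (i : ℤ) - 2) ⊗ₖ A (i : ℤ) + A ((m : ℤ) - (i : ℤ) - 1) ⊗ₖ A (i : ℤ)) =
      ((m : ℂ) * (Real.cos (Real.pi / (2 * m)) : ℂ) ^ 2) • (σx ⊗ₖ σx - σy ⊗ₖ σy) +
        ((m : ℂ) / 2 * (Real.sin (Real.pi / m) : ℂ)) • (σx ⊗ₖ σy + σy ⊗ₖ σx) := by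
  intro σx σy φ A
  have hm0 : (m : ℝ) ≠ 0 := by positivity
  set d : ℝ := Real.pi / (2 * m) with hd
  have h2d : Real.pi / m = 2 * d := by rw [hd]; field_simp
  have hA (j : ℤ) (s : ℝ) (h : φ j = Real.pi - s) :
      A j = (Real.sin s : ℂ) • σx + (Real.cos s : ℂ) • σy := by
    simp only [A, h, Real.sin_pi_sub, Real.cos_pi_sub, Complex.ofReal_neg, neg_smul,
      sub_neg_eq_add]
  have h₁ (i : ℕ) := hA ((m : ℤ) - i - 2) (φ i) (by simp only [φ]; push_cast; field_simp; ring)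
  have h₂ (i : ℕ) := hA ((m : ℤ) - i - 1) (φ i - 2 * d)
    (by simp only [φ, hd]; push_cast; field_simp; ring)
  have hφ (i : ℕ) : 2 * φ i = 2 * Real.pi * i / m + 2 * Real.pi / m := by
    simp only [φ]; push_cast; ring
  simp_rw [h₁, h₂]
  refine (Finset.sum_congr rfl fun (i : ℕ) _ =>
    kronecker_add_kronecker_eq σx σy (φ i) d).trans ?_
  rw [Finset.sum_sub_distrib, Finset.sum_const,
    Finset.sum_add_distrib, ← Finset.sum_smul, ← Finset.sum_smul, ← Complex.ofReal_sum,
    ← Complex.ofReal_sum]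
  simp_rw [Finset.sum_add_distrib, hφ, add_sub_assoc, sum_range_cos_add_eq_zero hm,
    sum_range_sin_add_eq_zero hm]
  rw [Finset.card_range, h2d, ← Nat.cast_smul_eq_nsmul ℂ]
  simp only [add_zero, Complex.ofReal_zero, smul_add, smul_smul]
  module
end

section
/- Let m ≥ 2 be an integer and set α_m := m·cos²(π/(2m)), β_m := (m/2)·sin(π/m). Let B := α_m·(σx ⊗ σx − σy ⊗ σy) + β_m·(σx ⊗ σy + σy ⊗ σx) as a 4×4 complex matrix (Kronecker products of Pauli matrices), and let ψ ∈ ℂ⁴ be the vector (1/√2)·( e^{−iπ/(2m)}·|00⟩ − |11⟩ ), i.e. with coordinates (e^{−iπ/(2m)}/√2, 0, 0, −1/√2) in the basis |00⟩, |01⟩, |10⟩, |11⟩. Then the inner product ⟨ψ, B ψ⟩ equals −2m·cos(π/(2m)). -/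
open Kronecker Matrix

/-- The state `ψ_m = (e^{−iπ/2m}|00⟩ − |11⟩)/√2` attains the value
`−2m cos(π/2m)` on the chained-inequality Bell operator
`B = m cos²(π/2m)(σx⊗σx − σy⊗σy) + (m/2) sin(π/m)(σx⊗σy + σy⊗σx)`. -/
theorem chained_quantum_value (m : ℕ) (hm : 2 ≤ m) :
    let σx : Matrix (Fin 2) (Fin 2) ℂ := !![0, 1; 1, 0]
    let σy : Matrix (Fin 2) (Fin 2) ℂ := !![0, -Complex.I; Complex.I, 0]
    let B : Matrix (Fin 2 × Fin 2) (Fin 2 × Fin 2) ℂ :=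
      ((m : ℂ) * (Real.cos (Real.pi / (2 * m)) : ℂ) ^ 2) • (σx ⊗ₖ σx - σy ⊗ₖ σy) +
        ((m : ℂ) / 2 * (Real.sin (Real.pi / m) : ℂ)) • (σx ⊗ₖ σy + σy ⊗ₖ σx)
    let ψ : Fin 2 × Fin 2 → ℂ := fun p =>
      if p = (0, 0) then Complex.exp (-(Real.pi / (2 * m) : ℝ) * Complex.I) / (Real.sqrt 2 : ℂ)
      else if p = (1, 1) then -(1 / (Real.sqrt 2 : ℂ))
      else 0
    star ψ ⬝ᵥ B.mulVec ψ = -(2 * (m : ℂ) * (Real.cos (Real.pi / (2 * m)) : ℂ)) := by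
  intro σx σy B ψ
  have hm0 : (m : ℝ) ≠ 0 := by positivity
  set θ : ℝ := Real.pi / (2 * m) with hθ
  have hsin : Real.sin (Real.pi / m) = 2 * Real.sin θ * Real.cos θ := by
    rw [← Real.sin_two_mul, hθ]
    congr 1
    field_simp
  have hexp : Complex.exp (-(θ : ℂ) * Complex.I) = Real.cos θ - Real.sin θ * Complex.I := by
    rw [Complex.exp_mul_I, Complex.cos_neg, Complex.sin_neg, Complex.ofReal_cos,
      Complex.ofReal_sin]
    ring
  have hsqrt : (Real.sqrt 2 : ℂ) ^ 2 = 2 := by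
    exact_mod_cast Real.sq_sqrt (by norm_num : (0 : ℝ) ≤ 2)
  have hsqrt0 : (Real.sqrt 2 : ℂ) ≠ 0 := by
    intro h
    simp [h] at hsqrt
  have htrig : (Real.sin θ : ℂ) ^ 2 + (Real.cos θ : ℂ) ^ 2 = 1 := by
    exact_mod_cast Real.sin_sq_add_cos_sq θ
  simp only [B, ψ, σx, σy, ← hθ, hexp, hsin]
  generalize Real.cos θ = c at *
  generalize Real.sin θ = s at *
  simp [dotProduct, mulVec, Fintype.sum_prod_type, Fin.sum_univ_two, kroneckerMap_apply,
    Prod.ext_iff]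
  field_simp
  rw [hsqrt]
  linear_combination (-4 * (m : ℂ) * (c : ℂ)) * htrig +
    4 * (m : ℂ) * (c : ℂ) * (s : ℂ) ^ 2 * Complex.I_sq
end

section
/- Let m ≥ 2 and let n ≥ 2 be an even integer; let ε ∈ ℝ. For M : ZMod (2n) → Fin m → ℝ with all values in {−1, 1}, extended at each site by M(i)(−1) := −M(i)(m−1), define I(M) := Σ_{i ∈ ZMod(2n)} (1 + (−1)^i·ε) · Σ_{j=0}^{m−1} ( M(i)(m−j−2)·M(i+1)(j) + M(i)(m−j−1)·M(i+1)(j) ), where (−1)^i is well defined since 2n is even. Then the minimum of I(M) over all such ±1-valued assignments equals −4n(m−1)·max(1, |ε|). -/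
/-- A sequence of signs with `x (-1) = -x (m - 1)` has a sign change on `-1, …, m - 1`. -/
lemma exists_add_eq_zero_of_antiperiodic {m : ℕ} {x : ℤ → ℝ}
    (hx : ∀ k : ℤ, -1 ≤ k → k < m → x k = 1 ∨ x k = -1) (hm : 0 < m)
    (hanti : x (-1) = -x ((m : ℤ) - 1)) :
    ∃ j < m, x ((m : ℤ) - j - 2) + x ((m : ℤ) - j - 1) = 0 := by
  by_contra! hne
  have hconst : ∀ j : ℕ, j ≤ m → x ((m : ℤ) - j - 1) = x ((m : ℤ) - 1) := by
    intro j
    induction j with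
    | zero => simp
    | succ j ih =>
      intro hj
      have h := hne j (by lia)
      rw [← ih (by lia)]
      have e : (m : ℤ) - ((j + 1 : ℕ) : ℤ) - 1 = (m : ℤ) - j - 2 := by push_cast; ring
      rw [e]
      rcases hx ((m : ℤ) - j - 2) (by lia) (by lia) with h1 | h1 <;>
        rcases hx ((m : ℤ) - j - 1) (by lia) (by lia) with h2 | h2 <;>
        simp_all
  have h := hconst m le_rfl
  simp only [sub_self, zero_sub] at h
  rcases hx ((m : ℤ) - 1) (by lia) (by lia) with h1 | h1 <;> rw [hanti, h1] at h <;>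
    norm_num at h

/-- The classical bound of the bipartite chained Bell expression. -/
lemma abs_chained_le {m : ℕ} (hm : 0 < m) {x y : ℤ → ℝ}
    (hx : ∀ k : ℤ, 0 ≤ k → k < m → x k = 1 ∨ x k = -1)
    (hy : ∀ k : ℤ, 0 ≤ k → k < m → y k = 1 ∨ y k = -1)
    (hanti : x (-1) = -x ((m : ℤ) - 1)) :
    |∑ j ∈ Finset.range m, (x ((m : ℤ) - j - 2) * y j + x ((m : ℤ) - j - 1) * y j)|
      ≤ 2 * ((m : ℝ) - 1) := by
  have hx' : ∀ k : ℤ, -1 ≤ k → k < m → x k = 1 ∨ x k = -1 := by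
    intro k hk hkm
    rcases hk.eq_or_lt with rfl | hk
    · rw [hanti]
      rcases hx ((m : ℤ) - 1) (by lia) (by lia) with h | h <;> simp [h]
    · exact hx k (by lia) hkm
  obtain ⟨a, ham, ha⟩ := exists_add_eq_zero_of_antiperiodic hx' hm hanti
  have ha' : a ∈ Finset.range m := Finset.mem_range.2 ham
  rw [← Finset.add_sum_erase _ _ ha', ← add_mul, ha, zero_mul, zero_add]
  refine (Finset.abs_sum_le_sum_abs _ _).trans ((Finset.sum_le_card_nsmul _ _ 2 ?_).trans ?_)
  · intro j hj
    have hj' : j < m := Finset.mem_range.1 (Finset.mem_of_mem_erase hj)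
    rcases hx' ((m : ℤ) - j - 2) (by lia) (by lia) with h1 | h1 <;>
      rcases hx' ((m : ℤ) - j - 1) (by lia) (by lia) with h2 | h2 <;>
      rcases hy j (by lia) (by lia) with h3 | h3 <;>
      norm_num [h1, h2, h3]
  · rw [Finset.card_erase_of_mem ha', Finset.card_range, nsmul_eq_mul, Nat.cast_pred hm, mul_comm]

/-- The bipartite chained Bell expression at constant strategies. -/
lemma chained_const {m : ℕ} (hm : 0 < m) (a b : ℝ) {x y : ℤ → ℝ}
    (hx : ∀ k : ℤ, 0 ≤ k → x k = a) (hx' : x (-1) = -a) (hy : ∀ k : ℤ, 0 ≤ k → y k = b) :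
    ∑ j ∈ Finset.range m, (x ((m : ℤ) - j - 2) * y j + x ((m : ℤ) - j - 1) * y j)
      = 2 * ((m : ℝ) - 1) * (a * b) := by
  obtain ⟨p, rfl⟩ : ∃ p, m = p + 1 := ⟨m - 1, by lia⟩
  have e1 : (((p + 1 : ℕ) : ℤ) - p - 2) = -1 := by push_cast; ring
  have e2 : (((p + 1 : ℕ) : ℤ) - p - 1) = 0 := by push_cast; ring
  rw [Finset.sum_range_succ, Finset.sum_congr rfl (g := fun _ => 2 * (a * b)), e1, e2, hx',
    hx 0 le_rfl, hy p (by lia)]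
  · simp only [Finset.sum_const, Finset.card_range, nsmul_eq_mul]
    push_cast
    ring
  · intro j hj
    have hj' := Finset.mem_range.1 hj
    rw [hx _ (by lia), hx _ (by lia), hy _ (by lia)]
    ring

lemma abs_one_add_add_abs_one_sub (ε : ℝ) : |1 + ε| + |1 - ε| = 2 * max 1 |ε| := by
  rcases max_cases 1 |ε| with ⟨h1, h2⟩ | ⟨h1, h2⟩ <;> rw [h1] <;>
    rcases abs_cases ε with ⟨h3, h4⟩ | ⟨h3, h4⟩ <;>
    rcases abs_cases (1 + ε) with ⟨h5, h6⟩ | ⟨h5, h6⟩ <;>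
    rcases abs_cases (1 - ε) with ⟨h7, h8⟩ | ⟨h7, h8⟩ <;> linarith

/-- A function on `ℕ` whose period divides `N` commutes with the successor of `ZMod N`. -/
lemma Function.Periodic.apply_val_add_one {α : Type*} {g : ℕ → α} {d N : ℕ} [NeZero N]
    (hg : Function.Periodic g d) (hd : d ∣ N) (i : ZMod N) : g (i + 1).val = g (i.val + 1) := by
  have hN : Function.Periodic g N := by
    obtain ⟨c, rfl⟩ := hd
    rw [mul_comm]
    exact hg.nat_mul c
  rw [ZMod.val_add, ZMod.val_one_eq_one_mod, Nat.add_mod_mod, hN.map_mod_nat]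

lemma periodic_neg_one_pow : Function.Periodic (fun k : ℕ => (-1 : ℝ) ^ k) 2 := by
  intro k
  simp [pow_add]

lemma sum_abs_weights (n : ℕ) [NeZero (2 * n)] (ε : ℝ) :
    ∑ i : ZMod (2 * n), |1 + (-1 : ℝ) ^ i.val * ε| = 2 * n * max 1 |ε| := by
  have h := Equiv.sum_comp (Equiv.addRight (1 : ZMod (2 * n)))
    (fun i => |1 + (-1 : ℝ) ^ i.val * ε|)
  have h2 : ∑ i : ZMod (2 * n), (|1 + (-1 : ℝ) ^ i.val * ε| + |1 + (-1 : ℝ) ^ (i + 1).val * ε|)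
      = ∑ _i : ZMod (2 * n), 2 * max 1 |ε| := by
    refine Finset.sum_congr rfl fun i _ => ?_
    rw [periodic_neg_one_pow.apply_val_add_one (dvd_mul_right 2 n) i, ← abs_one_add_add_abs_one_sub]
    rw [pow_succ]
    rcases neg_one_pow_eq_or ℝ i.val with h | h <;> rw [h] <;> ring_nf
  simp only [Equiv.coe_addRight] at h
  rw [Finset.sum_add_distrib, h] at h2
  simp only [Finset.sum_const, Finset.card_univ, ZMod.card, nsmul_eq_mul] at h2
  push_cast at h2
  linarith

/-- Signs of period four realizing the optimal sign of every edge of the ring. -/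
lemma exists_optimal_signs (ε : ℝ) :
    ∃ g : ℕ → ℝ, Function.Periodic g 4 ∧ (∀ k, g k = 1 ∨ g k = -1) ∧
      ∀ k, (1 + (-1 : ℝ) ^ k * ε) * (g k * g (k + 1)) = -|1 + (-1 : ℝ) ^ k * ε| := by
  have hpar : ∀ k : ℕ, (∃ t, k = 2 * t) ∨ ∃ t, k = 2 * t + 1 := fun k => k.even_or_odd'.elim
    fun t h => h.imp (fun h => ⟨t, h⟩) fun h => ⟨t, h⟩
  have hdiv : ∀ t : ℕ, (2 * t + 1) / 2 = t ∧ (2 * t + 1 + 1) / 2 = t + 1 ∧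
      (2 * t + 1 + 1 + 1) / 2 = t + 1 := fun t => by lia
  have hsq : ∀ t : ℕ, (-1 : ℝ) ^ t * (-1) ^ t = 1 := fun t => by
    rcases neg_one_pow_eq_or ℝ t with h | h <;> simp [h]
  have hev : ∀ t : ℕ, (-1 : ℝ) ^ (2 * t) = 1 := fun t => by simp
  have hodd : ∀ t : ℕ, (-1 : ℝ) ^ (2 * t + 1) = -1 := fun t => by simp [pow_succ]
  have hsucc : ∀ t : ℕ, (-1 : ℝ) ^ (t + 1) = -(-1) ^ t := fun t => by simp [pow_succ]
  by_cases h1 : |ε| ≤ 1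
  · refine ⟨fun k => (-1) ^ k, fun k => by simp [pow_succ], neg_one_pow_eq_or ℝ,
      fun k => ?_⟩
    have ⟨h2, h3⟩ := abs_le.1 h1
    have h : (-1 : ℝ) ^ k * (-1) ^ (k + 1) = -1 := by rw [pow_succ, ← mul_assoc, hsq]; ring
    rw [h, abs_of_nonneg, mul_neg_one]
    rcases neg_one_pow_eq_or ℝ k with h | h <;> rw [h] <;> linarith
  rcases lt_abs.1 (not_le.1 h1) with h2 | h2
  · refine ⟨fun k => (-1) ^ ((k + 1) / 2), fun k => ?_, fun k => neg_one_pow_eq_or ℝ _,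
      fun k => ?_⟩
    · have e : (k + 4 + 1) / 2 = (k + 1) / 2 + 2 := by lia
      simp [e, pow_add]
    · rcases hpar k with ⟨t, rfl⟩ | ⟨t, rfl⟩
      · have h := hsq t
        simp only [hdiv, hev, hsucc t]
        rw [abs_of_nonneg (by linarith)]
        linear_combination -(1 + ε) * h
      · have h := hsq (t + 1)
        simp only [hdiv, hodd, h]
        rw [abs_of_nonpos (by linarith)]
        ring
  · refine ⟨fun k => (-1) ^ (k / 2), fun k => ?_, fun k => neg_one_pow_eq_or ℝ _,
      fun k => ?_⟩
    · have e : (k + 4) / 2 = k / 2 + 2 := by lia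
      simp [e, pow_add]
    · rcases hpar k with ⟨t, rfl⟩ | ⟨t, rfl⟩
      · have h := hsq t
        have e : 2 * t / 2 = t := by lia
        simp only [hdiv, e, h, hev]
        rw [abs_of_nonpos (by linarith)]
        ring
      · have h := hsq t
        simp only [hdiv, hodd, hsucc t]
        rw [abs_of_nonneg (by linarith)]
        linear_combination -(1 - ε) * h

/-- Classical bound of the quasi translationally invariant chained Bell
inequality on a ring of `2n` parties (even `n`): the minimum over deterministic ±1-valued
local strategies `M` (with the convention `M i (−1) = −M i (m−1)`) of
`Σ_i (1 + (−1)^i ε) Σ_{j<m} (M i (m−j−2) + M i (m−j−1))·M (i+1) j` is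
`−4n(m−1)·max(1,|ε|)`. -/
theorem quasi_TI_chained_classical_bound (m n : ℕ) (hm : 2 ≤ m) (hn : 2 ≤ n)
    (hneven : Even n) (ε : ℝ) [NeZero n] :
    IsLeast
      {v : ℝ | ∃ M : ZMod (2 * n) → ℤ → ℝ,
        (∀ (i : ZMod (2 * n)) (k : ℤ), 0 ≤ k → k < m → M i k = 1 ∨ M i k = -1) ∧
        (∀ i : ZMod (2 * n), M i (-1) = -M i ((m : ℤ) - 1)) ∧
        v = ∑ i : ZMod (2 * n),
          (1 + (-1 : ℝ) ^ i.val * ε) *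
            ∑ j ∈ Finset.range m,
              (M i ((m : ℤ) - (j : ℤ) - 2) * M (i + 1) (j : ℤ) +
                M i ((m : ℤ) - (j : ℤ) - 1) * M (i + 1) (j : ℤ))}
      (-(4 * (n : ℝ) * ((m : ℝ) - 1) * max 1 |ε|)) := by
  have hm0 : 0 < m := by lia
  have : NeZero (2 * n) := ⟨by lia⟩
  have hval : -(4 * (n : ℝ) * ((m : ℝ) - 1) * max 1 |ε|)
      = ∑ i : ZMod (2 * n), -|1 + (-1 : ℝ) ^ i.val * ε| * (2 * ((m : ℝ) - 1)) := by
    rw [← Finset.sum_mul, Finset.sum_neg_distrib, sum_abs_weights]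
    ring
  rw [hval]
  constructor
  · obtain ⟨g, hg, hsign, hopt⟩ := exists_optimal_signs ε
    have h4 : 4 ∣ 2 * n := by
      obtain ⟨t, rfl⟩ := hneven
      exact ⟨t, by ring⟩
    refine ⟨fun i k => if 0 ≤ k then g i.val else -g i.val, fun i k hk _ => ?_, fun i => ?_,
      Finset.sum_congr rfl fun i _ => ?_⟩
    · simpa [hk] using hsign i.val
    · have h : (0 : ℤ) ≤ (m : ℤ) - 1 := by lia
      simp only [if_pos h]
      simp
    · rw [chained_const hm0 (g i.val) (g (i + 1).val) (fun k hk => if_pos hk) (by simp)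
        (fun k hk => if_pos hk), hg.apply_val_add_one h4, ← hopt]
      ring
  · rintro v ⟨M, hM, hanti, rfl⟩
    refine Finset.sum_le_sum fun i _ => ?_
    have h := abs_chained_le hm0 (hM i) (hM (i + 1)) (hanti i)
    refine le_trans ?_ (neg_abs_le _)
    rw [abs_mul, neg_mul]
    gcongr
end

section
/- For every integer m ≥ 2, ( m/(m−1) ) · cos( π/(2m) ) > 1. -/
/-- For every integer `m ≥ 2`, `(m/(m−1))·cos(π/(2m)) > 1`. -/
theorem chained_ratio_gt_one (m : ℕ) (hm : 2 ≤ m) :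
    1 < (m : ℝ) / ((m : ℝ) - 1) * Real.cos (Real.pi / (2 * m)) := by
  have hm' : (2 : ℝ) ≤ m := by exact_mod_cast hm
  have hpi : Real.pi ^ 2 < 16 := by nlinarith [Real.pi_pos, Real.pi_lt_four]
  have hquad : (m : ℝ) - 1 < m * (1 - (Real.pi / (2 * m)) ^ 2 / 2) := by
    have heq : (m : ℝ) * (1 - (Real.pi / (2 * m)) ^ 2 / 2) = m - Real.pi ^ 2 / (8 * m) := by
      field_simp
      ring
    have hlt : Real.pi ^ 2 / (8 * m) < 1 := by
      rw [div_lt_one (by positivity)]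
      linarith
    linarith
  rw [div_mul_eq_mul_div, one_lt_div (by linarith)]
  exact hquad.trans_le (by gcongr; exact Real.one_sub_sq_div_two_le_cos)
end

section
/- Let S be the 4×3 integer matrix with rows (1,1,1), (1,−1,−1), (−1,1,−1), (−1,−1,1). For A : Fin 4 → ℝ and B : Fin 3 → ℝ with all values in {−1, 1}, define I(A,B) := Σ_{i=0}^{3} Σ_{j=0}^{2} S_{ij}·A(i)·B(j). Then |I(A,B)| ≤ 6 for all such A, B, and there exist ±1-valued A, B with I(A,B) = 6 and ±1-valued A, B with I(A,B) = −6. -/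
/-- Gisin's Elegant Bell inequality: for ±1-valued deterministic assignments
`A : Fin 4 → ℝ`, `B : Fin 3 → ℝ`, the expression `Σ_{i,j} S_{ij} A_i B_j` with the stated sign
matrix `S` satisfies `|I| ≤ 6`, and both bounds `6` and `−6` are attained. -/
theorem elegant_classical_bound :
    let S : Matrix (Fin 4) (Fin 3) ℝ := !![1, 1, 1; 1, -1, -1; -1, 1, -1; -1, -1, 1]
    (∀ (A : Fin 4 → ℝ) (B : Fin 3 → ℝ),
        (∀ i, A i = 1 ∨ A i = -1) → (∀ j, B j = 1 ∨ B j = -1) →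
        |∑ i, ∑ j, S i j * A i * B j| ≤ 6) ∧
    (∃ (A : Fin 4 → ℝ) (B : Fin 3 → ℝ),
        (∀ i, A i = 1 ∨ A i = -1) ∧ (∀ j, B j = 1 ∨ B j = -1) ∧
        ∑ i, ∑ j, S i j * A i * B j = 6) ∧
    (∃ (A : Fin 4 → ℝ) (B : Fin 3 → ℝ),
        (∀ i, A i = 1 ∨ A i = -1) ∧ (∀ j, B j = 1 ∨ B j = -1) ∧
        ∑ i, ∑ j, S i j * A i * B j = -6) := by
  intro S
  have expand (A : Fin 4 → ℝ) (B : Fin 3 → ℝ) : ∑ i, ∑ j, S i j * A i * B j =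
      A 0 * (B 0 + B 1 + B 2) + A 1 * (B 0 - B 1 - B 2) +
        A 2 * (-B 0 + B 1 - B 2) + A 3 * (-B 0 - B 1 + B 2) := by
    simp [S, Fin.sum_univ_succ]
    ring
  simp only [expand]
  refine ⟨fun A B hA hB => ?_, ⟨![1, -1, -1, -1], ![1, 1, 1], ?_, ?_, ?_⟩,
    ⟨![-1, 1, 1, 1], ![1, 1, 1], ?_, ?_, ?_⟩⟩
  · have hA' (i : Fin 4) : -1 ≤ A i ∧ A i ≤ 1 := by
      rcases hA i with h | h <;> norm_num [h]
    obtain ⟨l₀, u₀⟩ := hA' 0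
    obtain ⟨l₁, u₁⟩ := hA' 1
    obtain ⟨l₂, u₂⟩ := hA' 2
    obtain ⟨l₃, u₃⟩ := hA' 3
    rw [abs_le]
    rcases hB 0 with h₀ | h₀ <;> rcases hB 1 with h₁ | h₁ <;> rcases hB 2 with h₂ | h₂ <;>
      rw [h₀, h₁, h₂] <;> constructor <;> linarith
  · simp [Fin.forall_fin_succ]
  · simp [Fin.forall_fin_succ]
  · simp; norm_num
  · simp [Fin.forall_fin_succ]
  · simp [Fin.forall_fin_succ]
  · simp; norm_num
end

section
/- Let Δ ∈ ℝ and let S_Δ be the 4×3 real matrix with rows (1,1,Δ), (1,−1,−Δ), (−1,1,−Δ), (−1,−1,Δ). For A : Fin 4 → ℝ and B : Fin 3 → ℝ with all values in {−1, 1}, define J(A,B) := Σ_{i=0}^{3} Σ_{j=0}^{2} (S_Δ)_{ij}·A(i)·B(j). Then the minimum of J(A,B) over all such ±1-valued assignments equals: 4Δ if Δ ≤ −2; −4 + 2Δ if −2 < Δ ≤ 0; −4 − 2Δ if 0 < Δ ≤ 2; and −4Δ if Δ > 2. -/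
set_option maxHeartbeats 2000000 in
/-- The classical bound of the Δ-modified Elegant Bell inequality: the minimum
of `Σ_{i,j} (S_Δ)_{ij} A_i B_j` over ±1-valued assignments equals the stated piecewise
function of `Δ`. -/
theorem modified_elegant_classical_bound (Δ : ℝ) :
    IsLeast
      {v : ℝ | ∃ (A : Fin 4 → ℝ) (B : Fin 3 → ℝ),
        (∀ i, A i = 1 ∨ A i = -1) ∧ (∀ j, B j = 1 ∨ B j = -1) ∧
        v = ∑ i, ∑ j,
          (!![1, 1, Δ; 1, -1, -Δ; -1, 1, -Δ; -1, -1, Δ] : Matrix (Fin 4) (Fin 3) ℝ) i j *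
            A i * B j}
      (if Δ ≤ -2 then 4 * Δ
       else if Δ ≤ 0 then -4 + 2 * Δ
       else if Δ ≤ 2 then -4 - 2 * Δ
       else -4 * Δ) := by
  simp only [Fin.sum_univ_four, Fin.sum_univ_three, Matrix.of_apply, Matrix.cons_val]
  constructor
  · split_ifs
    · exact ⟨![1, -1, -1, 1], ![1, 1, 1], by simp [Fin.forall_fin_succ],
        by simp [Fin.forall_fin_succ], by simp; ring⟩
    · exact ⟨![-1, -1, -1, 1], ![1, 1, 1], by simp [Fin.forall_fin_succ],
        by simp [Fin.forall_fin_succ], by simp; ring⟩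
    · exact ⟨![-1, 1, 1, 1], ![1, 1, 1], by simp [Fin.forall_fin_succ],
        by simp [Fin.forall_fin_succ], by simp; ring⟩
    · exact ⟨![-1, 1, 1, -1], ![1, 1, 1], by simp [Fin.forall_fin_succ],
        by simp [Fin.forall_fin_succ], by simp; ring⟩
  · rintro v ⟨A, B, hA, hB, rfl⟩
    rcases hA 0 with h₀ | h₀ <;> rcases hA 1 with h₁ | h₁ <;>
      rcases hA 2 with h₂ | h₂ <;> rcases hA 3 with h₃ | h₃ <;>
      rcases hB 0 with k₀ | k₀ <;> rcases hB 1 with k₁ | k₁ <;>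
      rcases hB 2 with k₂ | k₂ <;>
      rw [h₀, h₁, h₂, h₃, k₀, k₁, k₂] <;> split_ifs <;> linarith
end

section
/- Let σx = [[0,1],[1,0]], σy = [[0,−i],[i,0]], σz = [[1,0],[0,−1]] be the Pauli matrices over ℂ. Define A₀ = (σx+σy+σz)/√3, A₁ = (σx−σy−σz)/√3, A₂ = (−σx+σy−σz)/√3, A₃ = (−σx−σy+σz)/√3, and B₀ = σx, B₁ = σy, B₂ = σz. Let Δ ∈ ℝ and let S_Δ be the 4×3 real matrix with rows (1,1,Δ), (1,−1,−Δ), (−1,1,−Δ), (−1,−1,Δ). Then Σ_{i=0}^{3} Σ_{j=0}^{2} (S_Δ)_{ij} · (A_i ⊗ B_j) = (4/√3)·( σx ⊗ σx + σy ⊗ σy + Δ·σz ⊗ σz ), where ⊗ is the Kronecker product of 2×2 complex matrices. -/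
open Kronecker

/-- With the cube-diagonal observables `A_i` and Pauli observables `B_j`, the
Bell operator of the Δ-modified Elegant Bell inequality is the XXZ coupling
`(4/√3)(σx⊗σx + σy⊗σy + Δ·σz⊗σz)`. -/
theorem modified_elegant_bell_operator (Δ : ℝ) :
    let σx : Matrix (Fin 2) (Fin 2) ℂ := !![0, 1; 1, 0]
    let σy : Matrix (Fin 2) (Fin 2) ℂ := !![0, -Complex.I; Complex.I, 0]
    let σz : Matrix (Fin 2) (Fin 2) ℂ := !![1, 0; 0, -1]
    let A : Fin 4 → Matrix (Fin 2) (Fin 2) ℂ :=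
      ![((Real.sqrt 3 : ℂ))⁻¹ • (σx + σy + σz),
        ((Real.sqrt 3 : ℂ))⁻¹ • (σx - σy - σz),
        ((Real.sqrt 3 : ℂ))⁻¹ • (-σx + σy - σz),
        ((Real.sqrt 3 : ℂ))⁻¹ • (-σx - σy + σz)]
    let B : Fin 3 → Matrix (Fin 2) (Fin 2) ℂ := ![σx, σy, σz]
    let S : Matrix (Fin 4) (Fin 3) ℝ := !![1, 1, Δ; 1, -1, -Δ; -1, 1, -Δ; -1, -1, Δ]
    ∑ i, ∑ j, (S i j : ℂ) • (A i ⊗ₖ B j) =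
      ((4 / Real.sqrt 3 : ℝ) : ℂ) • (σx ⊗ₖ σx + σy ⊗ₖ σy + (Δ : ℂ) • (σz ⊗ₖ σz)) := by
  intro σx σy σz A B S
  clear_value σx σy σz
  simp only [A, B, S, Fin.sum_univ_four, Fin.sum_univ_three, Matrix.of_apply, Matrix.cons_val]
  ext ⟨i, j⟩ ⟨k, l⟩
  simp only [Matrix.add_apply, Matrix.sub_apply, Matrix.neg_apply, Matrix.smul_apply,
    Matrix.kroneckerMap_apply, smul_eq_mul]
  push_cast
  ring
end

section
/- For M : ZMod 8 → Fin 3 → ℝ with all values in {−1, 1}, define I(M) := Σ_{i ∈ ZMod 8} [ 2·M(i)(0)·M(i+1)(0) − 2·M(i)(0)·M(i+1)(1) + 2·M(i)(1)·M(i+1)(0) − 2·M(i)(1)·M(i+1)(1) − M(i)(0)·M(i+1)(2)·M(i+2)(0) − M(i)(0)·M(i+1)(2)·M(i+2)(1) + M(i)(1)·M(i+1)(2)·M(i+2)(0) + M(i)(1)·M(i+1)(2)·M(i+2)(1) ]. Then the minimum of I(M) over all such ±1-valued assignments equals −32. -/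
/-- Local bound on one term of the Bell expression, up to a telescoping correction. Here `x`, `y`
are the outcomes of the first two measurements of a party and `z` that of the third one. -/
theorem bell_term_lower_bound {x₀ y₀ x₁ y₁ z₁ x₂ y₂ : ℝ}
    (hx₀ : x₀ = 1 ∨ x₀ = -1) (hy₀ : y₀ = 1 ∨ y₀ = -1)
    (hx₁ : x₁ = 1 ∨ x₁ = -1) (hy₁ : y₁ = 1 ∨ y₁ = -1) (hz₁ : z₁ = 1 ∨ z₁ = -1)
    (hx₂ : x₂ = 1 ∨ x₂ = -1) (hy₂ : y₂ = 1 ∨ y₂ = -1) :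
    -4 + ((1 + x₁ * y₁) * (1 - x₂ * y₂) - (1 + x₀ * y₀) * (1 - x₁ * y₁)) ≤
      2 * x₀ * x₁ - 2 * x₀ * y₁ + 2 * y₀ * x₁ - 2 * y₀ * y₁ -
        x₀ * z₁ * x₂ - x₀ * z₁ * y₂ + y₀ * z₁ * x₂ + y₀ * z₁ * y₂ := by
  rcases hx₀ with rfl | rfl <;> rcases hy₀ with rfl | rfl <;> rcases hx₁ with rfl | rfl <;>
    rcases hy₁ with rfl | rfl <;> rcases hz₁ with rfl | rfl <;> rcases hx₂ with rfl | rfl <;>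
    rcases hy₂ with rfl | rfl <;> norm_num


/-- The classical bound of the 8-party translationally invariant Bell
expression of Example IV.A: the minimum over ±1-valued deterministic local strategies
`M : ZMod 8 → Fin 3 → ℝ` of the stated expression equals `−32`. -/
theorem eight_party_TI_classical_bound :
    IsLeast
      {v : ℝ | ∃ M : ZMod 8 → Fin 3 → ℝ,
        (∀ i j, M i j = 1 ∨ M i j = -1) ∧
        v = ∑ i : ZMod 8,
          (2 * M i 0 * M (i + 1) 0 - 2 * M i 0 * M (i + 1) 1 +
            2 * M i 1 * M (i + 1) 0 - 2 * M i 1 * M (i + 1) 1 -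
            M i 0 * M (i + 1) 2 * M (i + 2) 0 - M i 0 * M (i + 1) 2 * M (i + 2) 1 +
            M i 1 * M (i + 1) 2 * M (i + 2) 0 + M i 1 * M (i + 1) 2 * M (i + 2) 1)}
      (-32) := by
  constructor
  · let N : ZMod 8 → Fin 3 → ℤ := fun i j => if j = 0 ∧ i.val % 2 = 1 then -1 else 1
    have hN : ∀ i j, N i j = 1 ∨ N i j = -1 := by decide
    have hsum : (-32 : ℤ) = ∑ i : ZMod 8,
        (2 * N i 0 * N (i + 1) 0 - 2 * N i 0 * N (i + 1) 1 +
          2 * N i 1 * N (i + 1) 0 - 2 * N i 1 * N (i + 1) 1 -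
          N i 0 * N (i + 1) 2 * N (i + 2) 0 - N i 0 * N (i + 1) 2 * N (i + 2) 1 +
          N i 1 * N (i + 1) 2 * N (i + 2) 0 + N i 1 * N (i + 1) 2 * N (i + 2) 1) := by
      decide
    refine ⟨fun i j => N i j, fun i j => ?_, ?_⟩ <;> beta_reduce
    · exact_mod_cast hN i j
    · exact_mod_cast hsum
  · rintro v ⟨M, hM, rfl⟩
    let f : ZMod 8 → ℝ := fun i => (1 + M i 0 * M i 1) * (1 - M (i + 1) 0 * M (i + 1) 1)
    have hshift : ∑ i, f (i + 1) = ∑ i, f i := Equiv.sum_comp (Equiv.addRight 1) f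
    have htotal : ∑ i : ZMod 8, (-4 + (f (i + 1) - f i)) = -32 := by
      rw [Finset.sum_add_distrib, Finset.sum_sub_distrib, hshift, Finset.sum_const,
        Finset.card_univ, ZMod.card]
      norm_num
    rw [← htotal]
    refine Finset.sum_le_sum fun i _ => ?_
    have hi : i + 1 + 1 = i + 2 := by ring
    simp only [f, hi]
    exact bell_term_lower_bound (hM _ _) (hM _ _) (hM _ _) (hM _ _) (hM _ _) (hM _ _) (hM _ _)
end
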